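/- Let k be a field of characteristic p > 0 and R = k[a₁, a₂, b₁, b₂, c₁, c₂]. There is no Frobenius splitting φ of R (i.e., an additive map φ: R → R satisfying φ(f^p·g) = f·φ(g) for all f, g ∈ R and φ(1) = 1) such that φ(Iⱼ) ⊆ Iⱼ for all three ideals I₁ = (a₁b₂ − a₂b₁), I₂ = (a₁c₂ − a₂c₁), I₃ = (b₁c₂ − b₂c₁); in other words, no Frobenius splitting of this type D quiver representation variety compatibly splits all three codimension-one quiver loci simultaneously. -/

import Mathlib

open MvPolynomial

/-- Let `k` be a field of characteristic `p > 0` and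
`R = k[a₁,a₂,b₁,b₂,c₁,c₂]` (variables `X 0,…,X 5` in the order `a₁,a₂,b₁,b₂,c₁,c₂`).
There is no Frobenius splitting `φ` of `R` (an additive map with `φ(f^p·g) = f·φ(g)` and
`φ(1) = 1`) which compatibly splits the three ideals
`I₁ = (a₁b₂ − a₂b₁)`, `I₂ = (a₁c₂ − a₂c₁)`, `I₃ = (b₁c₂ − b₂c₁)` simultaneously. -/
theorem stmt16 (k : Type*) [Field k] (p : ℕ) [Fact p.Prime] [CharP k p] :
    ¬ ∃ φ : MvPolynomial (Fin 6) k → MvPolynomial (Fin 6) k,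
        (∀ x y, φ (x + y) = φ x + φ y) ∧
        (∀ f g, φ (f ^ p * g) = f * φ g) ∧
        φ 1 = 1 ∧
        (∀ x ∈ Ideal.span {(X 0 * X 3 - X 1 * X 2 : MvPolynomial (Fin 6) k)},
          φ x ∈ Ideal.span {(X 0 * X 3 - X 1 * X 2 : MvPolynomial (Fin 6) k)}) ∧
        (∀ x ∈ Ideal.span {(X 0 * X 5 - X 1 * X 4 : MvPolynomial (Fin 6) k)},
          φ x ∈ Ideal.span {(X 0 * X 5 - X 1 * X 4 : MvPolynomial (Fin 6) k)}) ∧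
        (∀ x ∈ Ideal.span {(X 2 * X 5 - X 3 * X 4 : MvPolynomial (Fin 6) k)},
          φ x ∈ Ideal.span {(X 2 * X 5 - X 3 * X 4 : MvPolynomial (Fin 6) k)}) := by
  rintro ⟨φ, hadd, hmul, h1, H1, H2, H3⟩
  obtain ⟨n, hn⟩ := Nat.exists_eq_add_of_le (Fact.out : p.Prime).two_le
  -- `u = c₁ D₁` satisfies `u² ∈ (D₃) + (D₁ D₂)`, hence so does `u = φ (u ^ p)`
  have key : φ ((X 4 * (X 0 * X 3 - X 1 * X 2)) ^ p * 1) = X 4 * (X 0 * X 3 - X 1 * X 2) := by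
    rw [hmul, h1, mul_one]
  have hu : ((X 4 * (X 0 * X 3 - X 1 * X 2)) ^ p * 1 : MvPolynomial (Fin 6) k) =
      (X 2 * X 5 - X 3 * X 4) *
        ((X 4 * (X 0 * X 3 - X 1 * X 2)) ^ n * X 4 * (X 0 * X 3 - X 1 * X 2) * (-X 0)) +
      (X 0 * X 3 - X 1 * X 2) * ((X 0 * X 5 - X 1 * X 4) *
        ((X 4 * (X 0 * X 3 - X 1 * X 2)) ^ n * X 4 * X 2)) := by
    rw [hn, pow_add]; ring
  rw [hu, hadd] at key
  have m3 := H3 _ (Ideal.mem_span_singleton.2 (Dvd.intro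
    ((X 4 * (X 0 * X 3 - X 1 * X 2)) ^ n * X 4 * (X 0 * X 3 - X 1 * X 2) * (-X 0)) rfl))
  have m1 := H1 _ (Ideal.mem_span_singleton.2 (Dvd.intro
    ((X 0 * X 5 - X 1 * X 4) * ((X 4 * (X 0 * X 3 - X 1 * X 2)) ^ n * X 4 * X 2)) rfl))
  have m2 := H2 ((X 0 * X 3 - X 1 * X 2) * ((X 0 * X 5 - X 1 * X 4) *
        ((X 4 * (X 0 * X 3 - X 1 * X 2)) ^ n * X 4 * X 2)))
    (Ideal.mem_span_singleton.2 ((Dvd.intro _ rfl).mul_left _))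
  rw [Ideal.mem_span_singleton] at m1 m2 m3
  obtain ⟨r, hr⟩ := m3
  obtain ⟨t, ht⟩ := m1
  obtain ⟨t', ht'⟩ := m2
  rw [hr, ht] at key
  rw [ht] at ht'
  clear hr ht hu H1 H2 H3 hadd hmul h1
  let S1 : MvPolynomial (Fin 6) k →ₐ[k] Polynomial k :=
    aeval ![1, 0, 1, Polynomial.X, 1, 0]
  let S2 : MvPolynomial (Fin 6) k →ₐ[k] Polynomial k :=
    aeval ![1, 0, 1, Polynomial.X, 1, Polynomial.X]
  have e : (Polynomial.aeval (0 : k)).comp S1 = (Polynomial.aeval (0 : k)).comp S2 := by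
    ext i
    fin_cases i <;> simp [S1, S2]
  have e' : Polynomial.aeval (0 : k) (S1 t) = Polynomial.aeval (0 : k) (S2 t) :=
    DFunLike.congr_fun e t
  have a1 : S1 t = 0 := by
    have := congrArg S1 ht'
    simpa [S1] using this
  have a2 : S2 t = 1 := by
    have := congrArg S2 key
    simpa [S2] using this
  rw [a1, a2] at e'
  simp at e'
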